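/- arXiv:1606.02788 — 3 statements merged into one kernel-verified Lean document; each statement's English description precedes it below -/
import Mathlib

section
/- Suppose that for all X, Y, Z, W ∈ V one has C(Z,Y)·⟨X,W⟩ − C(X,Y)·⟨Z,W⟩ = C(Z,W)·⟨X,Y⟩ − C(X,W)·⟨Y,Z⟩ (i.e., for each fixed pair X, Z the endomorphism Y ↦ C(Z,Y)X − C(X,Y)Z of V is self-adjoint). Then for all X, W ∈ V one has (tr C)·⟨X,W⟩ + (n−2)·C(X,W) = 0. -/
open scoped RealInnerProductSpace

/-- Expanding a vector in an orthonormal basis and applying a linear functional to it. -/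
theorem OrthonormalBasis.sum_apply_mul_inner {ι V : Type*} [Fintype ι]
    [NormedAddCommGroup V] [InnerProductSpace ℝ V]
    (b : OrthonormalBasis ι ℝ V) (f : V →ₗ[ℝ] ℝ) (W : V) :
    ∑ i, f (b i) * ⟪b i, W⟫ = f W := by
  conv_rhs => rw [← b.sum_repr' W]
  simp [mul_comm]

/-- If the symmetric bilinear form `C` on an `n`-dimensional real inner product space
satisfies `C(Z,Y)⟨X,W⟩ − C(X,Y)⟨Z,W⟩ = C(Z,W)⟨X,Y⟩ − C(X,W)⟨Y,Z⟩` for all vectors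
(i.e. `Y ↦ C(Z,Y)X − C(X,Y)Z` is self-adjoint for all `X, Z`), then
`(tr C)⟨X,W⟩ + (n−2) C(X,W) = 0` for all `X, W`. -/
theorem trace_identity_of_selfadjoint_condition
    {V : Type*} [NormedAddCommGroup V] [InnerProductSpace ℝ V] [FiniteDimensional ℝ V]
    (n : ℕ) (hn : Module.finrank ℝ V = n)
    (C : V →ₗ[ℝ] V →ₗ[ℝ] ℝ) (hsymm : ∀ X Y : V, C X Y = C Y X)
    (h : ∀ X Y Z W : V,
      C Z Y * ⟪X, W⟫ - C X Y * ⟪Z, W⟫ = C Z W * ⟪X, Y⟫ - C X W * ⟪Y, Z⟫) :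
    ∀ X W : V,
      (∑ i, C (stdOrthonormalBasis ℝ V i) (stdOrthonormalBasis ℝ V i)) * ⟪X, W⟫
        + ((n : ℝ) - 2) * C X W = 0 := by
  intro X W
  set b := stdOrthonormalBasis ℝ V
  have key := Finset.sum_congr rfl fun i (_ : i ∈ Finset.univ) => h X (b i) (b i) W
  have hXW : ∑ i, C X (b i) * ⟪b i, W⟫ = C X W := b.sum_apply_mul_inner (C X) W
  have hWX : ∑ i, C (b i) W * ⟪X, b i⟫ = C X W := by
    rw [hsymm X W, ← b.sum_apply_mul_inner (C W) X]
    exact Finset.sum_congr rfl fun i _ => by rw [hsymm (b i) W, real_inner_comm]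
  have hn' : ∑ i, C X W * ⟪b i, b i⟫ = n * C X W := by
    simp [hn]
  rw [Finset.sum_sub_distrib, Finset.sum_sub_distrib, ← Finset.sum_mul, hXW, hWX, hn'] at key
  linarith
end

section
/- Suppose that for all X, Y, Z, W ∈ V one has C(Z,Y)·⟨X,W⟩ − C(X,Y)·⟨Z,W⟩ = C(Z,W)·⟨X,Y⟩ − C(X,W)·⟨Y,Z⟩ (i.e., for each fixed pair X, Z the endomorphism Y ↦ C(Z,Y)X − C(X,Y)Z of V is self-adjoint). If n ≥ 2 then tr C = 0, and if n > 2 then C = 0 identically. -/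
open scoped RealInnerProductSpace

/-- Expanding the first argument of a bilinear form in an orthonormal basis. -/
lemma OrthonormalBasis.sum_bilin_mul_inner {V ι : Type*} [NormedAddCommGroup V]
    [InnerProductSpace ℝ V] [Fintype ι] (b : OrthonormalBasis ι ℝ V)
    (C : V →ₗ[ℝ] V →ₗ[ℝ] ℝ) (Z Y : V) : ∑ i, C (b i) Y * ⟪Z, b i⟫ = C Z Y := by
  conv_rhs => rw [← b.sum_repr' Z]
  simp [LinearMap.sum_apply, real_inner_comm, mul_comm]

/-- If the symmetric bilinear form `C` on an `n`-dimensional real inner product space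
satisfies `C(Z,Y)⟨X,W⟩ − C(X,Y)⟨Z,W⟩ = C(Z,W)⟨X,Y⟩ − C(X,W)⟨Y,Z⟩` for all vectors
(i.e. `Y ↦ C(Z,Y)X − C(X,Y)Z` is self-adjoint for all `X, Z`), then `tr C = 0` when
`n ≥ 2`, and `C = 0` identically when `n > 2`. -/
theorem traceless_and_vanishing_of_selfadjoint_condition
    {V : Type*} [NormedAddCommGroup V] [InnerProductSpace ℝ V] [FiniteDimensional ℝ V]
    (n : ℕ) (hn : Module.finrank ℝ V = n)
    (C : V →ₗ[ℝ] V →ₗ[ℝ] ℝ) (hsymm : ∀ X Y : V, C X Y = C Y X)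
    (h : ∀ X Y Z W : V,
      C Z Y * ⟪X, W⟫ - C X Y * ⟪Z, W⟫ = C Z W * ⟪X, Y⟫ - C X W * ⟪Y, Z⟫) :
    (2 ≤ n → ∑ i, C (stdOrthonormalBasis ℝ V i) (stdOrthonormalBasis ℝ V i) = 0) ∧
    (2 < n → ∀ X W : V, C X W = 0) := by
  set b := stdOrthonormalBasis ℝ V
  set T := ∑ i, C (b i) (b i) with hT
  have contracted : ∀ Z Y : V, ((n : ℝ) - 2) * C Z Y = -(T * ⟪Y, Z⟫) := by
    intro Z Y
    have hsum := Finset.sum_congr (rfl : Finset.univ = Finset.univ)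
      fun i _ => h (b i) Y Z (b i)
    have hZ : ∑ i, C Z (b i) * ⟪b i, Y⟫ = C Z Y := by
      rw [hsymm Z Y, ← b.sum_bilin_mul_inner C Y Z]
      exact Finset.sum_congr rfl fun i _ => by rw [hsymm, real_inner_comm]
    have hcard : ∑ i, C Z Y * ⟪b i, b i⟫ = n * C Z Y := by
      simp [hn]
    rw [Finset.sum_sub_distrib, Finset.sum_sub_distrib, b.sum_bilin_mul_inner, hZ, hcard,
      ← Finset.sum_mul, ← hT] at hsum
    linarith
  have trace_eq_zero : 2 ≤ n → T = 0 := by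
    intro h2
    have hsum := Finset.sum_congr (rfl : Finset.univ = Finset.univ)
      fun i _ => contracted (b i) (b i)
    have hcard : ∑ i, -(T * ⟪b i, b i⟫) = -(n * T) := by
      simp [hn]
    rw [← Finset.mul_sum, ← hT, hcard] at hsum
    have h2' : (2 : ℝ) ≤ n := by exact_mod_cast h2
    have hprod : ((n : ℝ) - 1) * T = 0 := by linarith
    exact (mul_eq_zero.mp hprod).resolve_left (by linarith)
  refine ⟨trace_eq_zero, fun h2 X W => ?_⟩
  have hXW := contracted X W
  rw [trace_eq_zero h2.le, zero_mul, neg_zero] at hXW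
  have h2' : (2 : ℝ) < n := by exact_mod_cast h2
  exact (mul_eq_zero.mp hXW).resolve_left (by linarith)
end

section
/- Let B be a self-adjoint endomorphism of V and set C(X,Y) = ⟨B X, Y⟩, a symmetric bilinear form. Suppose that for all X, Y, Z ∈ V the vector identity C(Z,Y)·X − C(X,Y)·Z + ⟨Y,Z⟩·B(X) − ⟨Y,X⟩·B(Z) = 0 holds. Then (tr C)·⟨X,W⟩ + (n−2)·C(X,W) = 0 for all X, W ∈ V; consequently, if n ≥ 2 then tr B = 0, and if n > 2 then B = 0. -/
open scoped RealInnerProductSpace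

/-- Let `B` be a self-adjoint endomorphism of an `n`-dimensional real inner product space
and `C(X,Y) = ⟨B X, Y⟩` the associated symmetric bilinear form.  If
`C(Z,Y)·X − C(X,Y)·Z + ⟨Y,Z⟩·B(X) − ⟨Y,X⟩·B(Z) = 0` for all `X, Y, Z`, then
`(tr C)⟨X,W⟩ + (n−2) C(X,W) = 0` for all `X, W`; consequently `tr B = 0` when `n ≥ 2`
and `B = 0` when `n > 2`. -/
theorem selfadjoint_endomorphism_vanishing
    {V : Type*} [NormedAddCommGroup V] [InnerProductSpace ℝ V] [FiniteDimensional ℝ V]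
    (n : ℕ) (hn : Module.finrank ℝ V = n)
    (B : V →ₗ[ℝ] V) (hB : ∀ X Y : V, ⟪B X, Y⟫ = ⟪X, B Y⟫)
    (h : ∀ X Y Z : V,
      ⟪B Z, Y⟫ • X - ⟪B X, Y⟫ • Z + ⟪Y, Z⟫ • B X - ⟪Y, X⟫ • B Z = 0) :
    (∀ X W : V,
      (LinearMap.trace ℝ V B) * ⟪X, W⟫ + ((n : ℝ) - 2) * ⟪B X, W⟫ = 0) ∧
    (2 ≤ n → LinearMap.trace ℝ V B = 0) ∧
    (2 < n → B = 0) := by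
  have trace_smul_add (X : V) :
      LinearMap.trace ℝ V B • X + ((n : ℝ) - 2) • B X = 0 := by
    let b := stdOrthonormalBasis ℝ V
    have hsum := Finset.sum_eq_zero fun i (_ : i ∈ Finset.univ) => h X (b i) (b i)
    have hBX : ∑ i, ⟪B X, b i⟫ • b i = B X := by
      simpa only [real_inner_comm] using b.sum_repr' (B X)
    have hX : ∑ i, ⟪b i, X⟫ • B (b i) = B X := by
      simpa only [map_sum, map_smul] using congrArg B (b.sum_repr' X)
    have htr : ∑ i, ⟪B (b i), b i⟫ = LinearMap.trace ℝ V B := by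
      simp only [LinearMap.trace_eq_sum_inner B b, hB]
    simp only [Finset.sum_add_distrib, Finset.sum_sub_distrib, ← Finset.sum_smul,
      hBX, hX, htr, b.inner_eq_one, Finset.sum_const, Finset.card_univ, Fintype.card_fin, hn,
      nsmul_eq_mul, mul_one] at hsum
    rw [← hsum]
    module
  have trace_eq_zero (hn2 : 2 ≤ n) : LinearMap.trace ℝ V B = 0 := by
    have hmap : LinearMap.trace ℝ V B • (LinearMap.id : V →ₗ[ℝ] V) + ((n : ℝ) - 2) • B = 0 :=
      LinearMap.ext trace_smul_add
    have htr := congrArg (LinearMap.trace ℝ V) hmap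
    simp only [map_add, map_smul, LinearMap.trace_id, hn, map_zero, smul_eq_mul] at htr
    have hn2' : (2 : ℝ) ≤ n := by exact_mod_cast hn2
    have hmul : (2 * (n : ℝ) - 2) * LinearMap.trace ℝ V B = 0 := by linear_combination htr
    exact (mul_eq_zero.mp hmul).resolve_left (by linarith)
  refine ⟨fun X W => ?_, trace_eq_zero, fun hn2 => LinearMap.ext fun X => ?_⟩
  · simpa only [inner_add_left, real_inner_smul_left, inner_zero_left] using
      congrArg (fun U => ⟪U, W⟫) (trace_smul_add X)
  · have hX := trace_smul_add X
    rw [trace_eq_zero hn2.le, zero_smul, zero_add] at hX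
    have hn2' : (2 : ℝ) < n := by exact_mod_cast hn2
    exact (smul_eq_zero.mp hX).resolve_left (by linarith)
end
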